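/- Let X be an infinite, compact, metrizable topological space, let α : X → X be a minimal homeomorphism, and let x₀, x₁ ∈ X be points with Orb(x₀) ∩ Orb(x₁) = ∅. Let U ⊆ X be a nonempty open set satisfying: (a) for every z ∈ U with z ≠ α(x₀) and z ≠ α(x₁), one has α⁻¹(z) ∈ U; and (b) for every z ∈ U with z ≠ x₀ and z ≠ x₁, one has α(z) ∈ U. Then U = X. -/

import Mathlib

theorem aux_cont {X : Type*} [TopologicalSpace X] (α : X ≃ₜ X) (n : ℤ) :
    Continuous (fun x => (α.toEquiv ^ n) x) := by
  induction n using Int.induction_on with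
  | zero => simpa using continuous_id'
  | succ i ih =>
    have : (fun x => (α.toEquiv ^ ((i : ℤ) + 1)) x) =
        (fun x => (α.toEquiv ^ (i : ℤ)) x) ∘ α := by
      funext x
      rw [zpow_add_one]; rfl
    rw [this]; exact ih.comp α.continuous
  | pred i ih =>
    have : (fun x => (α.toEquiv ^ (-(i : ℤ) - 1)) x) =
        (fun x => (α.toEquiv ^ (-(i : ℤ))) x) ∘ α.symm := by
      funext x
      rw [zpow_sub_one]; rfl
    rw [this]; exact ih.comp α.symm.continuous

theorem aux_bound {X : Type*} [TopologicalSpace X] [CompactSpace X] (α : X ≃ₜ X)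
    (hmin : ∀ x : X, Dense (Set.range fun n : ℤ => (α.toEquiv ^ n) x))
    (U : Set X) (hUopen : IsOpen U) (hUne : U.Nonempty) :
    ∃ N : ℕ, ∀ y : X, ∃ n : ℤ, -(N : ℤ) ≤ n ∧ n ≤ N ∧ (α.toEquiv ^ n) y ∈ U := by
  obtain ⟨t, ht⟩ := isCompact_univ.elim_finite_subcover
    (fun n : ℤ => (fun x => (α.toEquiv ^ n) x) ⁻¹' U)
    (fun n => hUopen.preimage (aux_cont α n))
    (by
      intro y _
      obtain ⟨_, hz, n, rfl⟩ := (hmin y).inter_open_nonempty U hUopen hUne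
      exact Set.mem_iUnion.2 ⟨n, hz⟩)
  refine ⟨t.sup Int.natAbs, fun y => ?_⟩
  have hy := ht (Set.mem_univ y)
  simp only [Set.mem_iUnion] at hy
  obtain ⟨n, hn, hy⟩ := hy
  have := Finset.le_sup (f := Int.natAbs) hn
  exact ⟨n, by omega, by omega, hy⟩

/-- For a minimal homeomorphism `α` of an infinite compact metrizable space and points
`x₀, x₁` with disjoint orbits, any nonempty open set `U` satisfying the invariance
conditions (a) and (b) must be all of `X`. -/
theorem stmt_14 {X : Type*} [TopologicalSpace X] [CompactSpace X]
    [TopologicalSpace.MetrizableSpace X] [Infinite X] (α : X ≃ₜ X)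
    (hmin : ∀ x : X, Dense (Set.range fun n : ℤ => (α.toEquiv ^ n) x))
    (x₀ x₁ : X)
    (horb : ∀ m n : ℤ, (α.toEquiv ^ n) x₁ ≠ (α.toEquiv ^ m) x₀)
    (U : Set X) (hUopen : IsOpen U) (hUne : U.Nonempty)
    (ha : ∀ z ∈ U, z ≠ α x₀ → z ≠ α x₁ → α.symm z ∈ U)
    (hb : ∀ z ∈ U, z ≠ x₀ → z ≠ x₁ → α z ∈ U) :
    U = Set.univ := by
  have hadd : ∀ (m n : ℤ) (x : X),
      (α.toEquiv ^ (m + n)) x = (α.toEquiv ^ m) ((α.toEquiv ^ n) x) := by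
    intro m n x
    rw [zpow_add]; rfl
  have hone : ∀ x : X, (α.toEquiv ^ (1 : ℤ)) x = α x := by
    intro x; rw [zpow_one]; rfl
  obtain ⟨N, hN⟩ := aux_bound α hmin U hUopen hUne
  -- no point is periodic
  have hper : ∀ (x : X) (p : ℤ), 0 < p → (α.toEquiv ^ p) x ≠ x := by
    intro x p hp h
    have hmul : ∀ q : ℤ, (α.toEquiv ^ (p * q)) x = x := by
      intro q
      rw [zpow_mul]
      exact Function.IsFixedPt.perm_zpow h q
    have hfin : (Set.range fun n : ℤ => (α.toEquiv ^ n) x).Finite := by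
      refine ((Set.finite_Ico (0 : ℤ) p).image (fun n : ℤ => (α.toEquiv ^ n) x)).subset ?_
      rintro _ ⟨n, rfl⟩
      refine ⟨n % p, ⟨Int.emod_nonneg _ hp.ne', Int.emod_lt_of_pos _ hp⟩, ?_⟩
      show _ = (α.toEquiv ^ n) x
      conv_rhs => rw [← Int.emod_add_mul_ediv n p, hadd, hmul]
    let _ := TopologicalSpace.metrizableSpaceMetric X
    have h2 := (hmin x).closure_eq
    rw [hfin.isClosed.closure_eq] at h2
    rw [h2] at hfin
    exact Set.infinite_univ hfin
  by_contra hU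
  obtain ⟨x, hx⟩ := (Set.ne_univ_iff_exists_notMem U).1 hU
  -- walking backward from a point of the forward orbit
  have hF : ∀ n : ℕ, (α.toEquiv ^ (n : ℤ)) x ∈ U →
      ∃ k : ℕ, (α.toEquiv ^ (k : ℤ)) x = x₀ ∨ (α.toEquiv ^ (k : ℤ)) x = x₁ := by
    intro n
    induction n with
    | zero => intro h; exact absurd (by simpa using h) hx
    | succ n ih =>
      intro h
      have e : (α.toEquiv ^ ((n + 1 : ℕ) : ℤ)) x = α ((α.toEquiv ^ (n : ℤ)) x) := by
        rw [← hone, ← hadd]; congr 2; push_cast; ring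
      rw [e] at h
      by_cases h0 : (α.toEquiv ^ (n : ℤ)) x = x₀
      · exact ⟨n, Or.inl h0⟩
      by_cases h1 : (α.toEquiv ^ (n : ℤ)) x = x₁
      · exact ⟨n, Or.inr h1⟩
      have := ha _ h (fun c => h0 (α.injective c)) (fun c => h1 (α.injective c))
      rw [α.symm_apply_apply] at this
      exact ih this
  have hB : ∀ n : ℕ, (α.toEquiv ^ (-(n : ℤ))) x ∈ U →
      ∃ k : ℕ, 0 < k ∧ ((α.toEquiv ^ (-(k : ℤ))) x = x₀ ∨ (α.toEquiv ^ (-(k : ℤ))) x = x₁) := by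
    intro n
    induction n with
    | zero => intro h; exact absurd (by simpa using h) hx
    | succ n ih =>
      intro h
      have e : α ((α.toEquiv ^ (-((n + 1 : ℕ) : ℤ))) x) = (α.toEquiv ^ (-(n : ℤ))) x := by
        rw [← hone, ← hadd]; congr 2; push_cast; ring
      by_cases h0 : (α.toEquiv ^ (-((n + 1 : ℕ) : ℤ))) x = x₀
      · exact ⟨n + 1, by omega, Or.inl h0⟩
      by_cases h1 : (α.toEquiv ^ (-((n + 1 : ℕ) : ℤ))) x = x₁
      · exact ⟨n + 1, by omega, Or.inr h1⟩
      have := hb _ h h0 h1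
      rw [e] at this
      exact ih this
  obtain ⟨k, hk⟩ : ∃ k : ℕ, (α.toEquiv ^ (k : ℤ)) x = x₀ ∨ (α.toEquiv ^ (k : ℤ)) x = x₁ := by
    obtain ⟨n, h1, h2, h3⟩ := hN ((α.toEquiv ^ (N : ℤ)) x)
    rw [← hadd] at h3
    obtain ⟨m, hm⟩ := Int.eq_ofNat_of_zero_le (show 0 ≤ n + N by omega)
    rw [hm] at h3
    exact hF m h3
  obtain ⟨j, hj0, hj⟩ : ∃ k : ℕ, 0 < k ∧
      ((α.toEquiv ^ (-(k : ℤ))) x = x₀ ∨ (α.toEquiv ^ (-(k : ℤ))) x = x₁) := by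
    obtain ⟨n, h1, h2, h3⟩ := hN ((α.toEquiv ^ (-(N : ℤ))) x)
    rw [← hadd] at h3
    obtain ⟨m, hm⟩ := Int.eq_ofNat_of_zero_le (show 0 ≤ -(n + -N) by omega)
    rw [show n + -(N : ℤ) = -(m : ℤ) by omega] at h3
    exact hB m h3
  have hrel : (α.toEquiv ^ ((k : ℤ) + j)) ((α.toEquiv ^ (-(j : ℤ))) x)
      = (α.toEquiv ^ (k : ℤ)) x := by
    rw [← hadd]; congr 2; ring
  have hpos : (0 : ℤ) < (k : ℤ) + j := by omega
  rcases hk with hk | hk <;> rcases hj with hj | hj <;> rw [hk, hj] at hrel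
  · exact hper _ _ hpos hrel
  · exact horb 0 _ (by simpa using hrel)
  · exact horb _ 0 (by simpa using hrel.symm)
  · exact hper _ _ hpos hrel
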